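/- Let R be a Noetherian integrally closed commutative domain, X = Spec(R), and S an open subscheme of X. Then the canonical restriction map R = Γ(X, O_X) → Γ(S, O_S) is an isomorphism if and only if the complement of S in X has codimension at least 2. -/

import Mathlib

open AlgebraicGeometry CategoryTheory TopologicalSpace

/-- In a Noetherian integrally closed domain, a prime of the form `(b : c)` with `b ≠ 0` has height
at most one. -/
theorem Ideal.height_le_one_of_forall_mem_iff_dvd {R : Type*} [CommRing R] [IsDomain R]
    [IsNoetherianRing R] [IsIntegrallyClosed R] (q : Ideal R) [hq : q.IsPrime] {b c : R}
    (hb : b ≠ 0) (h : ∀ r, r ∈ q ↔ b ∣ r * c) : q.height ≤ 1 := by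
  have hbc : ¬ b ∣ c := fun hd => hq.ne_top (q.eq_top_iff_one.2 ((h 1).2 (by simpa using hd)))
  have hb' : algebraMap R (FractionRing R) b ≠ 0 := by simpa using hb
  have hbq : b ∈ q := (h b).2 (dvd_mul_right b c)
  by_cases H : ∀ t ∈ q, ∃ u ∈ q, t * c = b * u
  · have hint :
        IsIntegral R (algebraMap R (FractionRing R) c / algebraMap R (FractionRing R) b) := by
      refine isIntegral_of_smul_mem_submodule
        (Submodule.map (Algebra.linearMap R (FractionRing R)) q) ?_
        ((IsNoetherian.noetherian q).map _) _ ?_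
      · rw [Submodule.ne_bot_iff]
        exact ⟨_, ⟨b, hbq, rfl⟩, hb'⟩
      · rintro _ ⟨t, ht, rfl⟩
        obtain ⟨u, hu, e⟩ := H t ht
        refine ⟨u, hu, ?_⟩
        have e' := congrArg (algebraMap R (FractionRing R)) e
        simp only [map_mul] at e'
        simp only [Algebra.linearMap_apply, smul_eq_mul]
        field_simp
        linear_combination -e'
    obtain ⟨y, hy⟩ := IsIntegrallyClosed.algebraMap_eq_of_integral hint
    refine absurd ⟨y, ?_⟩ hbc
    apply FaithfulSMul.algebraMap_injective R (FractionRing R)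
    rw [map_mul, hy, mul_div_cancel₀ _ hb']
  · push Not at H
    obtain ⟨t, ht, H⟩ := H
    obtain ⟨u, hu⟩ := (h t).1 ht
    have huq : u ∉ q := fun hq => H u hq hu
    refine Ideal.height_le_one_of_isPrincipal_of_mem_minimalPrimes (Ideal.span {t}) q
      ⟨⟨hq, by simpa [Ideal.span_le] using ht⟩, ?_⟩
    rintro p ⟨hp, htp⟩ hpq y hy
    obtain ⟨v, hv⟩ := (h y).1 hy
    have htv : t * v = u * y := mul_left_cancel₀ hb (by linear_combination y * hu - t * hv)
    refine (hp.mem_or_mem (x := u) (y := y) ?_).resolve_left fun hup => huq (hpq hup)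
    exact htv ▸ p.mul_mem_right v (htp (Ideal.mem_span_singleton_self t))

/-- In a Noetherian integrally closed domain, a fraction `a / b` which is regular at all primes of
height at most one lies in the ring. -/
theorem dvd_of_forall_height_le_one {R : Type*} [CommRing R] [IsDomain R]
    [IsNoetherianRing R] [IsIntegrallyClosed R] {a b : R} (hb : b ≠ 0)
    (h : ∀ p : PrimeSpectrum R, p.asIdeal.height ≤ 1 → ∃ r ∉ p.asIdeal, b ∣ r * a) : b ∣ a := by
  by_contra hba
  have hx : Ideal.Quotient.mk (Ideal.span {b}) a ≠ 0 := by
    rwa [Ne, Ideal.Quotient.eq_zero_iff_mem, Ideal.mem_span_singleton]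
  obtain ⟨q, hq, hle⟩ := exists_le_isAssociatedPrime_of_isNoetherianRing R _ hx
  have := hq.isPrime
  obtain ⟨-, y, hy⟩ := isAssociatedPrime_iff.1 hq
  obtain ⟨c, rfl⟩ := Ideal.Quotient.mk_surjective y
  have key (c r : R) : r ∈ (⊥ : Submodule R (R ⧸ Ideal.span {b})).colon
      {Ideal.Quotient.mk _ c} ↔ b ∣ r * c := by
    rw [Submodule.mem_colon_singleton, Submodule.mem_bot, ← Ideal.mem_span_singleton,
      ← Ideal.Quotient.eq_zero_iff_mem, map_mul]
    rfl
  obtain ⟨r, hr, hd⟩ := h ⟨q, this⟩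
    (q.height_le_one_of_forall_mem_iff_dvd hb fun r => hy ▸ key c r)
  exact hr (hle ((key a r).2 hd))

/-- A prime of height one in a Noetherian domain has the form `(b : c)` with `b ≠ 0`. -/
theorem Ideal.exists_forall_mem_iff_dvd_of_height_eq_one {R : Type*} [CommRing R] [IsDomain R]
    [IsNoetherianRing R] (q : Ideal R) [hq : q.IsPrime] (h : q.height = 1) :
    ∃ b c : R, b ≠ 0 ∧ ∀ r, r ∈ q ↔ b ∣ r * c := by
  obtain ⟨b, hbq, hb⟩ := q.ne_bot_iff.1 (Ideal.ne_bot_of_height_eq_one h)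
  have hle : Ideal.span {b} ≤ q := by simpa [Ideal.span_le] using hbq
  have hmin : q ∈ (Ideal.span {b}).minimalPrimes :=
    Ideal.mem_minimalPrimes_of_height_le hle (h.trans_le
      (Ideal.one_le_height_span_singleton_of_mem_nonZeroDivisors
        (mem_nonZeroDivisors_of_ne_zero hb)))
  have hass : q ∈ associatedPrimes R (R ⧸ Ideal.span {b}) := by
    apply Module.associatedPrimes.minimalPrimes_annihilator_subset_associatedPrimes
    rwa [Ideal.annihilator_quotient]
  obtain ⟨-, y, hy⟩ := isAssociatedPrime_iff.1 hass
  obtain ⟨c, rfl⟩ := Ideal.Quotient.mk_surjective y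
  refine ⟨b, c, hb, fun r => ?_⟩
  rw [hy, Submodule.mem_colon_singleton, Submodule.mem_bot, ← Ideal.mem_span_singleton,
      ← Ideal.Quotient.eq_zero_iff_mem, map_mul]
  rfl

open StructureSheaf

/-- Restriction of functions from `Spec R` to `S` is an isomorphism iff `R → Γ(S, O_S)` is bijective. -/
theorem isIso_structureSheaf_map_iff {R : Type} [CommRing R] (S : Opens (PrimeSpectrum R)) :
    IsIso ((Spec.structureSheaf R).val.map (homOfLE (le_top : S ≤ ⊤)).op) ↔
      Function.Bijective (algebraMap R ((structureSheafInType R R).obj.obj (.op S))) :=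
  (ConcreteCategory.isIso_iff_bijective _).trans
    (Function.Bijective.of_comp_iff _ (algebraMap_obj_top_bijective (R := R))).symm

theorem LocalizedModule.mk_eq_mk_primeCompl_iff {R : Type*} [CommRing R] [IsDomain R] {p : Ideal R}
    [p.IsPrime] {f f' : R} {g g' : p.primeCompl} :
    LocalizedModule.mk f g = LocalizedModule.mk f' g' ↔ g' * f = g * f' := by
  rw [LocalizedModule.mk_eq]
  refine ⟨fun ⟨u, hu⟩ => ?_, fun h => ⟨1, by simpa [Submonoid.smul_def] using h⟩⟩
  have hu0 : (u : R) ≠ 0 := fun h => u.2 (h ▸ p.zero_mem)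
  exact mul_left_cancel₀ hu0 (by simpa [Submonoid.smul_def] using hu)

/-- A section over a nonempty open subset of the spectrum of a domain is globally given by a
single element `a / b` of the fraction field. -/
theorem exists_fraction_of_section {R : Type*} [CommRing R] [IsDomain R]
    {S : Opens (PrimeSpectrum R)} (hS : (⊥ : PrimeSpectrum R) ∈ S)
    (s : (structureSheafInType R R).obj.obj (.op S)) :
    ∃ a b : R, b ≠ 0 ∧ ∀ p : S, ∃ (f g : R) (hg : g ∉ p.1.asIdeal),
      s.1 p = LocalizedModule.mk f ⟨g, hg⟩ ∧ b * f = g * a := by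
  have hfrac (p : S) : ∃ (f g : R) (hg : g ∉ p.1.asIdeal)
      (hg' : g ∉ (⊥ : PrimeSpectrum R).asIdeal),
      s.1 p = LocalizedModule.mk f ⟨g, hg⟩ ∧
        s.1 ⟨(⊥ : PrimeSpectrum R), hS⟩ = LocalizedModule.mk f ⟨g, hg'⟩ := by
    obtain ⟨V, hpV, i, f, g, h⟩ := s.2 p
    have hbot : (⊥ : PrimeSpectrum R) ∈ V :=
      ((PrimeSpectrum.le_iff_specializes ⊥ p.1).1 bot_le).mem_open V.2 hpV
    obtain ⟨hg, e⟩ := h ⟨p.1, hpV⟩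
    obtain ⟨hg', e'⟩ := h ⟨(⊥ : PrimeSpectrum R), hbot⟩
    exact ⟨f, g, hg, hg', e, e'⟩
  obtain ⟨a, b, hb, -, hab, -⟩ := hfrac ⟨⊥, hS⟩
  refine ⟨a, b, fun h => hb (h ▸ Ideal.zero_mem _), fun p => ?_⟩
  obtain ⟨f, g, hg, hg', e, e'⟩ := hfrac p
  exact ⟨f, g, hg, e, LocalizedModule.mk_eq_mk_primeCompl_iff.1 (e'.symm.trans hab)⟩

/-- An element `a / b` of the fraction field which is regular at all points of `S` defines a
section over `S`. -/
theorem exists_section_of_fraction {R : Type*} [CommRing R] [IsDomain R]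
    {S : Opens (PrimeSpectrum R)} {a b : R} (hb : b ≠ 0)
    (h : ∀ p ∈ S, ∃ r ∉ p.asIdeal, b ∣ r * a) :
    ∃ s : (structureSheafInType R R).obj.obj (.op S), ∀ p : S, ∃ (f g : R) (hg : g ∉ p.1.asIdeal),
      s.1 p = LocalizedModule.mk f ⟨g, hg⟩ ∧ b * f = g * a := by
  choose g hg f hf using fun p : S => h p.1 p.2
  refine ⟨⟨fun p => LocalizedModule.mk (f p) ⟨g p, hg p⟩, fun p => ?_⟩,
    fun p => ⟨f p, g p, hg p, rfl, (hf p).symm⟩⟩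
  refine ⟨S ⊓ PrimeSpectrum.basicOpen (g p), ⟨p.2, hg p⟩, Opens.infLELeft _ _, f p, g p,
    fun (q : (S ⊓ PrimeSpectrum.basicOpen (g p) : Opens (PrimeSpectrum R))) =>
      ⟨q.2.2, (LocalizedModule.mk_eq_mk_primeCompl_iff (p := q.1.asIdeal)).2
        (mul_left_cancel₀ hb ?_)⟩⟩
  have hp := hf p
  have hq := hf ⟨q.1, q.2.1⟩
  change b * (g p * f ⟨q.1, q.2.1⟩) = b * (g ⟨q.1, q.2.1⟩ * f p)
  linear_combination g ⟨q.1, q.2.1⟩ * hp - g p * hq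

/-- For a domain `R`, the map `R → Γ(S, O_S)` is bijective iff `S` is nonempty and every element of
the fraction field which is regular on `S` lies in `R`. -/
theorem bijective_algebraMap_structureSheaf_iff {R : Type*} [CommRing R] [IsDomain R]
    (S : Opens (PrimeSpectrum R)) :
    Function.Bijective (algebraMap R ((structureSheafInType R R).obj.obj (.op S))) ↔
      (⊥ : PrimeSpectrum R) ∈ S ∧
        ∀ a b : R, b ≠ 0 → (∀ p ∈ S, ∃ r ∉ p.asIdeal, b ∣ r * a) → b ∣ a := by
  have happ (r : R) (p : S) :
      (algebraMap R ((structureSheafInType R R).obj.obj (.op S)) r).1 p =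
        LocalizedModule.mk r (1 : p.1.asIdeal.primeCompl) := rfl
  constructor
  · intro hbij
    have hbot : (⊥ : PrimeSpectrum R) ∈ S := by
      by_contra hbot
      refine zero_ne_one (hbij.1 (Subtype.ext (funext fun p => absurd ?_ hbot)) : (0 : R) = 1)
      exact ((PrimeSpectrum.le_iff_specializes _ _).1 bot_le).mem_open S.2 p.2
    refine ⟨hbot, fun a b hb h => ?_⟩
    obtain ⟨s, hs⟩ := exists_section_of_fraction hb h
    obtain ⟨r, rfl⟩ := hbij.2 s
    obtain ⟨f, g, hg, e, hfg⟩ := hs ⟨⊥, hbot⟩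
    have hg0 : g ≠ 0 := fun h => hg (h ▸ Ideal.zero_mem _)
    have e' : g * r = 1 * f := LocalizedModule.mk_eq_mk_primeCompl_iff.1 ((happ _ _).symm.trans e)
    exact ⟨r, mul_left_cancel₀ hg0 (by linear_combination -b * e' - hfg)⟩
  · rintro ⟨hbot, H⟩
    constructor
    · intro r r' h
      have e := congrFun (congrArg Subtype.val h) ⟨(⊥ : PrimeSpectrum R), hbot⟩
      simpa using LocalizedModule.mk_eq_mk_primeCompl_iff.1 e
    · intro s
      obtain ⟨a, b, hb, hs⟩ := exists_fraction_of_section hbot s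
      obtain ⟨r, rfl⟩ := H a b hb fun p hp => by
        obtain ⟨f, g, hg, -, hfg⟩ := hs ⟨p, hp⟩
        exact ⟨g, hg, f, hfg.symm⟩
      refine ⟨r, Subtype.ext (funext fun p => ?_)⟩
      obtain ⟨f, g, hg, e, hfg⟩ := hs p
      refine ((happ r p).trans
        (LocalizedModule.mk_eq_mk_primeCompl_iff.2 (mul_left_cancel₀ hb ?_))).trans e.symm
      change b * (g * r) = b * (1 * f)
      linear_combination -hfg

/-- For a Noetherian integrally closed domain `R`, with `X = Spec R` and `S ⊆ X` open,
the canonical restriction map `R = Γ(X, O_X) → Γ(S, O_S)` is an isomorphism if and only if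
the complement of `S` has codimension at least 2 (i.e. every prime in the complement has
height at least 2). -/
theorem stmt0 (R : Type) [CommRing R] [IsDomain R] [IsNoetherianRing R]
    [IsIntegrallyClosed R]
    (S : Opens (PrimeSpectrum R)) :
    IsIso ((Spec.structureSheaf R).val.map (homOfLE (le_top : S ≤ ⊤)).op) ↔
      ∀ p : PrimeSpectrum R, p ∉ S → 2 ≤ Order.height p := by
  refine ((isIso_structureSheaf_map_iff S).trans
    (bijective_algebraMap_structureSheaf_iff S)).trans ?_
  constructor
  · rintro ⟨hbot, H⟩ p hp
    rw [← PrimeSpectrum.height_eq_orderHeight]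
    by_contra! hlt
    have hle : p.asIdeal.height ≤ 1 := Order.lt_add_one_iff_of_not_isMax (by simp) |>.1 hlt
    have h0 : p.asIdeal.height ≠ 0 := fun h => hp <| by
      rwa [show p = ⊥ from PrimeSpectrum.ext (Ideal.height_eq_zero_iff_eq_bot.1 h)]
    obtain ⟨b, c, hb, hbc⟩ := p.asIdeal.exists_forall_mem_iff_dvd_of_height_eq_one
      (hle.antisymm (Order.one_le_iff_ne_zero.2 h0))
    refine p.2.one_notMem ((hbc 1).2 ?_)
    rw [one_mul]
    refine H c b hb fun q hq => ?_
    have hpq : ¬ p.asIdeal ≤ q.asIdeal := fun h =>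
      hp (((PrimeSpectrum.le_iff_specializes p q).1 h).mem_open S.2 hq)
    obtain ⟨r, hr, hrq⟩ := SetLike.not_le_iff_exists.1 hpq
    exact ⟨r, hrq, (hbc r).1 hr⟩
  · intro H
    have hmem (p : PrimeSpectrum R) (h : p.asIdeal.height ≤ 1) : p ∈ S := by
      by_contra hp
      have := (H p hp).trans (PrimeSpectrum.height_eq_orderHeight p ▸ h)
      exact absurd this (by decide)
    exact ⟨hmem ⊥ (by simp [PrimeSpectrum.asIdeal_bot]),
      fun a b hb h => dvd_of_forall_height_le_one hb fun p hp => h p (hmem p hp)⟩
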